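/- arXiv:2002.08989 — 3 statements merged into one kernel-verified Lean document; each statement's English description precedes it below -/
import Mathlib

section
/- The antichain of size 2 (the 2-element partial order whose two elements are incomparable) is an ali order. -/
universe u

/-- The level of an element `x` of a partial order with well-founded `<`:
`Level(x) = sup { Level(y) + 1 : y < x }`, i.e. the rank of `x` with respect to `<`. -/
noncomputable def level (α : Type u) [PartialOrder α] [WellFoundedLT α] (x : α) : Ordinal.{u} :=
  IsWellFounded.rank (α := α) (· < ·) x

/-- Two elements of a partial order are incomparable. -/
def Incomp {α : Type u} [Preorder α] (a b : α) : Prop := ¬ a ≤ b ∧ ¬ b ≤ a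

/-- An order embedding `f : α ↪o β` is level-induced when
`Level(x) = Level(y) ↔ Level(f x) = Level(f y)` for all `x y`. -/
def LevelInduced {α β : Type u} [PartialOrder α] [WellFoundedLT α]
    [PartialOrder β] [WellFoundedLT β] (f : α ↪o β) : Prop :=
  ∀ x y : α, level α x = level α y ↔ level β (f x) = level β (f y)

/-- The gap between two elements: `max(Level x, Level y) - min(Level x, Level y)`
(ordinal subtraction). -/
noncomputable def gap (α : Type u) [PartialOrder α] [WellFoundedLT α] (x y : α) : Ordinal.{u} :=
  max (level α x) (level α y) - min (level α x) (level α y)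

/-- An order embedding `f : α ↪o β` is consecutive level-induced when it preserves gaps. -/
def ConsecutiveLevelInduced {α β : Type u} [PartialOrder α] [WellFoundedLT α]
    [PartialOrder β] [WellFoundedLT β] (f : α ↪o β) : Prop :=
  ∀ x y : α, gap α x y = gap β (f x) (f y)

/-- `α` is an ali order: whenever `α` order-embeds into a partial order `β` with
well-founded `<`, there is a level-induced order embedding of `α` into `β`. -/
def AliOrder (α : Type u) [PartialOrder α] [WellFoundedLT α] : Prop :=
  ∀ (β : Type u) [PartialOrder β] [WellFoundedLT β],
    Nonempty (α ↪o β) → ∃ f : α ↪o β, LevelInduced f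

/-- `α` is a nacli order: whenever there is a level-induced order embedding of `α` into a
partial order `β` with well-founded `<`, there is a consecutive level-induced order
embedding of `α` into `β`. -/
def NacliOrder (α : Type u) [PartialOrder α] [WellFoundedLT α] : Prop :=
  ∀ (β : Type u) [PartialOrder β] [WellFoundedLT β],
    (∃ f : α ↪o β, LevelInduced f) → ∃ g : α ↪o β, ConsecutiveLevelInduced g

theorem exists_lt_level {β : Type u} [PartialOrder β] [WellFoundedLT β] (o : Ordinal.{u}) (y : β) :
    o < level β y → ∃ z, z < y ∧ level β z = o := by
  induction y using WellFoundedLT.induction with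
  | ind y ih =>
  intro h
  unfold level at h
  have h2 : ∃ z, z < y ∧ o ≤ level β z := by
    by_contra hc
    push Not at hc
    rw [IsWellFounded.rank_eq] at h
    refine absurd h (not_lt.mpr (Ordinal.iSup_le ?_))
    rintro ⟨z, hz⟩
    exact Order.succ_le_of_lt (hc z hz)
  obtain ⟨z, hz, hoz⟩ := h2
  rcases hoz.eq_or_lt with e | l
  · exact ⟨z, hz, e.symm⟩
  · obtain ⟨w, hw, hw2⟩ := ih z hz l
    exact ⟨w, hw.trans hz, hw2⟩

theorem level_lt {β : Type u} [PartialOrder β] [WellFoundedLT β] {x y : β} (h : x < y) :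
    level β x < level β y := IsWellFounded.rank_lt_of_rel h

theorem exists_same_level {β : Type u} [PartialOrder β] [WellFoundedLT β] (x y : β)
    (h1 : ¬ x ≤ y) (h2 : ¬ y ≤ x) : ∃ p q : β, p ≠ q ∧ level β p = level β q := by
  rcases lt_trichotomy (level β x) (level β y) with h | h | h
  · obtain ⟨z, hz, e⟩ := exists_lt_level _ y h
    exact ⟨z, x, fun h => h1 (h ▸ hz.le), e⟩
  · exact ⟨x, y, fun e => h1 e.le, h⟩
  · obtain ⟨z, hz, e⟩ := exists_lt_level _ x h
    exact ⟨z, y, fun h => h2 (h ▸ hz.le), e⟩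

/-- The antichain of size 2 is an ali order. -/
theorem stmt7 (α : Type u) [PartialOrder α] [WellFoundedLT α]
    (a b : α) (hab : a ≠ b) (hinc : Incomp a b) (hcover : ∀ x : α, x = a ∨ x = b) :
    AliOrder α := by
  classical
  intro β _ _ ⟨f⟩
  have hmin : ∀ x y : α, ¬ x < y := by
    intro x y h
    rcases hcover x with rfl | rfl <;> rcases hcover y with rfl | rfl
    · exact lt_irrefl _ h
    · exact hinc.1 h.le
    · exact hinc.2 h.le
    · exact lt_irrefl _ h
  have hl : ∀ x y : α, level α x = level α y := by
    intro x y
    rcases lt_trichotomy (level α x) (level α y) with h | h | h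
    · obtain ⟨z, hz, -⟩ := exists_lt_level _ y h
      exact absurd hz (hmin _ _)
    · exact h
    · obtain ⟨z, hz, -⟩ := exists_lt_level _ x h
      exact absurd hz (hmin _ _)
  obtain ⟨p, q, hpq, he⟩ := exists_same_level (f a) (f b)
    (fun h => hinc.1 (f.le_iff_le.1 h)) (fun h => hinc.2 (f.le_iff_le.1 h))
  have hp : ¬ p ≤ q := fun h => (level_lt (lt_of_le_of_ne h hpq)).ne he
  have hq : ¬ q ≤ p := fun h => (level_lt (lt_of_le_of_ne h hpq.symm)).ne he.symm
  refine ⟨OrderEmbedding.ofMapLEIff (fun x => if x = a then p else q) ?_, ?_⟩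
  · intro x y
    rcases hcover x with rfl | rfl <;> rcases hcover y with rfl | rfl <;>
      simp [hab.symm, hp, hq, hinc.1, hinc.2]
  · intro x y
    refine iff_of_true (hl x y) ?_
    rcases hcover x with rfl | rfl <;> rcases hcover y with rfl | rfl <;>
      simp [hab.symm, he]
end

section
/- For every linear order C in which < is well-founded, the order composition of the 3-element order {x, y, z} with x < y and z incomparable to x and y (a chain of height 2 together with an incomparable element) followed by C (a '(2,1)-based chain') is an ali order. -/
universe u

theorem level_lt_of_lt {α : Type u} [PartialOrder α] [WellFoundedLT α] {a b : α} (h : a < b) :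
    level α a < level α b := IsWellFounded.rank_lt_of_rel (r := (· < ·)) h

theorem exists_level_eq {α : Type u} [PartialOrder α] [WellFoundedLT α] (o : Ordinal.{u}) (a : α) :
    o < level α a → ∃ b, b < a ∧ level α b = o := by
  induction a using WellFoundedLT.induction with
  | ind a ih =>
    intro h
    by_contra hc
    push Not at hc
    apply absurd h
    rw [not_lt, level, IsWellFounded.rank_eq]
    apply Ordinal.iSup_le
    rintro ⟨b, hb⟩
    rw [Order.succ_le_iff]
    by_contra hlt
    rcases (not_lt.1 hlt).lt_or_eq with h1 | h1
    · obtain ⟨d, hd, hd'⟩ := ih b hb h1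
      exact hc d (hd.trans hb) hd'
    · exact hc b hb h1.symm

theorem level_incomp {α : Type u} [PartialOrder α] [WellFoundedLT α] {a b : α}
    (h : level α a = level α b) (hne : a ≠ b) : Incomp a b :=
  ⟨fun hl => (level_lt_of_lt (lt_of_le_of_ne hl hne)).ne h,
   fun hl => (level_lt_of_lt (lt_of_le_of_ne hl hne.symm)).ne h.symm⟩

theorem build_emb (P : Type u) [PartialOrder P] [WellFoundedLT P]
    (x y z : P) (hxy : x < y) (hxz : Incomp x z) (hyz : Incomp y z)
    (hbelow : ∀ w : P, w ≠ x → w ≠ y → w ≠ z → (x < w ∧ y < w ∧ z < w))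
    (hchain : IsChain (· ≤ ·) {w : P | w ≠ x ∧ w ≠ y ∧ w ≠ z})
    (β : Type u) [PartialOrder β] [WellFoundedLT β] (f : P ↪o β) (p q r : β)
    (hpq : p < q) (hpr : Incomp p r) (hqr : Incomp q r) (hl : level β p = level β r)
    (hb : ∀ w : P, w ≠ x → w ≠ y → w ≠ z → (p < f w ∧ q < f w ∧ r < f w)) :
    ∃ g : P ↪o β, LevelInduced g := by
  classical
  have hne1 : y ≠ x := hxy.ne'
  have hne2 : z ≠ x := fun h => hxz.1 h.ge
  have hne3 : z ≠ y := fun h => hyz.1 h.ge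
  let g : P → β := fun w => if w = x then p else if w = y then q else if w = z then r else f w
  have gx : g x = p := by simp [g]
  have gy : g y = q := by simp [g, hne1]
  have gz : g z = r := by simp [g, hne2, hne3]
  have gw : ∀ w, w ≠ x → w ≠ y → w ≠ z → g w = f w := by
    intro w h1 h2 h3; simp [g, h1, h2, h3]
  have cases4 : ∀ w : P, w = x ∨ w = y ∨ w = z ∨ (w ≠ x ∧ w ≠ y ∧ w ≠ z) := by
    intro w; tauto
  have hle : ∀ u v, g u ≤ g v ↔ u ≤ v := by
    intro u v
    rcases cases4 u with rfl | rfl | rfl | ⟨u1, u2, u3⟩ <;>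
    rcases cases4 v with rfl | rfl | rfl | ⟨v1, v2, v3⟩
    all_goals first
      | exact iff_of_true le_rfl le_rfl
      | (rw [gw _ u1 u2 u3, gw _ v1 v2 v3]; exact f.le_iff_le)
      | (rw [gw _ u1 u2 u3]
         have h1 := hbelow _ u1 u2 u3
         have h2 := hb _ u1 u2 u3
         simp only [gx, gy, gz]
         first
          | exact iff_of_false h2.1.not_ge h1.1.not_ge
          | exact iff_of_false h2.2.1.not_ge h1.2.1.not_ge
          | exact iff_of_false h2.2.2.not_ge h1.2.2.not_ge)
      | (rw [gw _ v1 v2 v3]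
         have h1 := hbelow _ v1 v2 v3
         have h2 := hb _ v1 v2 v3
         simp only [gx, gy, gz]
         first
          | exact iff_of_true h2.1.le h1.1.le
          | exact iff_of_true h2.2.1.le h1.2.1.le
          | exact iff_of_true h2.2.2.le h1.2.2.le)
      | (simp only [gx, gy, gz]
         first
          | exact iff_of_true hpq.le hxy.le
          | exact iff_of_false hpq.not_ge hxy.not_ge
          | exact iff_of_false hpr.1 hxz.1
          | exact iff_of_false hpr.2 hxz.2
          | exact iff_of_false hqr.1 hyz.1
          | exact iff_of_false hqr.2 hyz.2)
  let G : P ↪o β := OrderEmbedding.ofMapLEIff g hle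
  have hGg : ∀ w, G w = g w := fun _ => rfl
  have hcomp : ∀ u v : P, u < v → ¬ level P u = level P v ∧ ¬ level β (g u) = level β (g v) := by
    intro u v h
    exact ⟨(level_lt_of_lt h).ne, (level_lt_of_lt (show g u < g v from G.lt_iff_lt.2 h)).ne⟩
  have hminx : level P x ≤ 0 := by
    by_contra h
    obtain ⟨b, hbb, -⟩ := exists_level_eq 0 x (not_le.1 h)
    rcases cases4 b with rfl | rfl | rfl | ⟨u1, u2, u3⟩
    · exact lt_irrefl _ hbb
    · exact lt_asymm hbb hxy
    · exact hxz.2 hbb.le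
    · exact lt_asymm hbb (hbelow b u1 u2 u3).1
  have hminz : level P z ≤ 0 := by
    by_contra h
    obtain ⟨b, hbb, -⟩ := exists_level_eq 0 z (not_le.1 h)
    rcases cases4 b with rfl | rfl | rfl | ⟨u1, u2, u3⟩
    · exact hxz.1 hbb.le
    · exact hyz.1 hbb.le
    · exact lt_irrefl _ hbb
    · exact lt_asymm hbb (hbelow b u1 u2 u3).2.2
  have hxzl : level P x = level P z := by
    rw [nonpos_iff_eq_zero.1 hminx, nonpos_iff_eq_zero.1 hminz]
  have hlg : level β (g x) = level β (g z) := by rw [gx, gz, hl]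
  have key : ∀ u v : P, (u = v ∨ u < v ∨ v < u) ∨ (u = x ∧ v = z) ∨ (u = z ∧ v = x) ∨
      (u = y ∧ v = z) ∨ (u = z ∧ v = y) := by
    intro u v
    rcases cases4 u with hu | hu | hu | ⟨u1, u2, u3⟩ <;>
    rcases cases4 v with hv | hv | hv | ⟨v1, v2, v3⟩
    all_goals first
      | (have := hbelow v v1 v2 v3; subst hu; simp [this]; done)
      | (have := hbelow u u1 u2 u3; subst hv; simp [this]; done)
      | (subst hu; subst hv; simp [hxy]; done)
      | skip
    left
    by_cases he : u = v
    · exact Or.inl he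
    · right
      rcases hchain ⟨u1, u2, u3⟩ ⟨v1, v2, v3⟩ he with h | h
      · exact Or.inl (lt_of_le_of_ne h he)
      · exact Or.inr (lt_of_le_of_ne h (Ne.symm he))
  have hyzl := hcomp x y hxy
  rw [hxzl, hlg] at hyzl
  refine ⟨G, fun u v => ?_⟩
  rw [hGg, hGg]
  rcases key u v with (rfl | h | h) | ⟨rfl, rfl⟩ | ⟨rfl, rfl⟩ | ⟨rfl, rfl⟩ | ⟨rfl, rfl⟩
  · simp
  · exact iff_of_false (hcomp u v h).1 (hcomp u v h).2
  · exact iff_of_false (Ne.symm (hcomp v u h).1) (Ne.symm (hcomp v u h).2)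
  · exact iff_of_true hxzl hlg
  · exact iff_of_true hxzl.symm hlg.symm
  · exact iff_of_false (Ne.symm hyzl.1) (Ne.symm hyzl.2)
  · exact iff_of_false hyzl.1 hyzl.2

/-- The order composition of the order `{x, y, z}` with `x < y` and `z` incomparable to
both, followed by a well-founded chain (a "(2,1)-based chain"), is an ali order. -/
theorem stmt13 (P : Type u) [PartialOrder P] [WellFoundedLT P]
    (x y z : P) (hxy : x < y) (hxz : Incomp x z) (hyz : Incomp y z)
    (hbelow : ∀ w : P, w ≠ x → w ≠ y → w ≠ z → (x < w ∧ y < w ∧ z < w))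
    (hchain : IsChain (· ≤ ·) {w : P | w ≠ x ∧ w ≠ y ∧ w ≠ z}) :
    AliOrder P := by
  intro β _ _ ⟨f⟩
  have fxy : f x < f y := f.lt_iff_lt.2 hxy
  have fxz : Incomp (f x) (f z) := ⟨fun h => hxz.1 (f.le_iff_le.1 h), fun h => hxz.2 (f.le_iff_le.1 h)⟩
  have fyz : Incomp (f y) (f z) := ⟨fun h => hyz.1 (f.le_iff_le.1 h), fun h => hyz.2 (f.le_iff_le.1 h)⟩
  have fb : ∀ w : P, w ≠ x → w ≠ y → w ≠ z → (f x < f w ∧ f y < f w ∧ f z < f w) := by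
    intro w h1 h2 h3
    have := hbelow w h1 h2 h3
    exact ⟨f.lt_iff_lt.2 this.1, f.lt_iff_lt.2 this.2.1, f.lt_iff_lt.2 this.2.2⟩
  rcases lt_trichotomy (level β (f x)) (level β (f z)) with h | h | h
  · obtain ⟨c, hc, hcl⟩ := exists_level_eq _ _ h
    refine build_emb P x y z hxy hxz hyz hbelow hchain β f c (f z) (f x) hc
      (level_incomp hcl ?_) ⟨fxz.2, fxz.1⟩ hcl ?_
    · rintro rfl; exact fxz.1 hc.le
    · intro w h1 h2 h3
      have := fb w h1 h2 h3
      exact ⟨hc.trans this.2.2, this.2.2, this.1⟩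
  · exact build_emb P x y z hxy hxz hyz hbelow hchain β f _ _ _ fxy fxz fyz h fb
  · obtain ⟨c, hc, hcl⟩ := exists_level_eq _ _ h
    refine build_emb P x y z hxy hxz hyz hbelow hchain β f c (f y) (f z) (hc.trans fxy)
      (level_incomp hcl ?_) fyz hcl ?_
    · rintro rfl; exact fxz.2 hc.le
    · intro w h1 h2 h3
      have := fb w h1 h2 h3
      exact ⟨hc.trans this.1, this.2⟩
end

section
/- No nacli order has more than one level of size at least 2: if P' is a nacli order and x ≠ y are elements with Level_{P'}(x) = Level_{P'}(y), and u ≠ v are elements with Level_{P'}(u) = Level_{P'}(v), then Level_{P'}(x) = Level_{P'}(u). -/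
universe u

theorem level_eq_of {β : Type u} [PartialOrder β] [WellFoundedLT β] (L : β → Ordinal.{u})
    (hm : StrictMono L) (hs : ∀ b, ∀ o < L b, ∃ c, c < b ∧ L c = o) (b : β) :
    level β b = L b := by
  induction b using WellFoundedLT.induction with
  | ind b ih =>
    apply le_antisymm
    · unfold level
      rw [IsWellFounded.rank_eq]
      apply Ordinal.iSup_le
      rintro ⟨c, hc⟩
      have h1 := ih c hc
      unfold level at h1
      rw [Order.succ_le_iff]
      simp only [h1]
      exact hm hc
    · by_contra hlt
      rw [not_le] at hlt
      obtain ⟨c, hc, hL⟩ := hs b _ hlt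
      have h1 := ih c hc
      have h2 : level β c < level β b := WellFoundedLT.rank_strictMono hc
      rw [h1, hL] at h2
      exact lt_irrefl _ h2

/-- Underlying type of the stretched order. -/
structure Stretch (α : Type u) (W : Type u) (p : α → Ordinal.{u}) (e : W → Ordinal.{u}) where
  val : α ⊕ W

/-- Order on the stretched order. -/
def Stretch.le {α W : Type u} [PartialOrder α] (p : α → Ordinal.{u}) (e : W → Ordinal.{u}) :
    α ⊕ W → α ⊕ W → Prop
  | .inl a, .inl b => a ≤ b
  | .inr a, .inr b => e a ≤ e b
  | .inr a, .inl b => e a < p b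
  | .inl _, .inr _ => False

theorem nacli_aux {α : Type u} [PartialOrder α] [WellFoundedLT α]
    (k : Ordinal.{u}) (hk : 0 < k) :
    ∃ (β : Type u) (_ : PartialOrder β) (_ : WellFoundedLT β) (f : α ↪o β),
      LevelInduced f ∧ ∀ a b : β, a ≠ b → level β a = level β b → ∃ o, level β a = k * o := by
  let p : α → Ordinal.{u} := fun a => k * level α a
  have hp : StrictMono p := fun a b hab =>
    (mul_lt_mul_iff_right₀ hk).2 (WellFoundedLT.rank_strictMono hab)
  let K : Ordinal.{u} := ⨆ a, p a
  have hK : ∀ a, p a ≤ K := fun a => Ordinal.le_iSup p a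
  let W := K.ToType
  let e : W → Ordinal.{u} := fun w => (Ordinal.ToType.mk.symm w : Set.Iio K).1
  have he : Function.Injective e := fun a b hab =>
    Ordinal.ToType.mk.symm.injective (Subtype.ext hab)
  have hes : ∀ o < K, ∃ w, e w = o := fun o ho =>
    ⟨Ordinal.ToType.mk ⟨o, ho⟩, by simp [e]⟩
  have heK : ∀ w, e w < K := fun w => (Ordinal.ToType.mk.symm w : Set.Iio K).2
  let β := Stretch α W p e
  let P : PartialOrder β :=
    { le := fun a b => Stretch.le p e a.val b.val
      le_refl := by
        rintro ⟨a | a⟩ <;> simp [Stretch.le]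
      le_trans := by
        rintro ⟨a | a⟩ ⟨b | b⟩ ⟨c | c⟩ <;> simp only [Stretch.le] <;> intro h1 h2
        · exact le_trans h1 h2
        · exact h2.elim
        · exact h1.elim
        · exact h1.elim
        · exact h1.trans_le (hp.monotone h2)
        · exact h2.elim
        · exact h1.trans_lt h2
        · exact h1.trans h2
      le_antisymm := by
        rintro ⟨a | a⟩ ⟨b | b⟩ <;> simp only [Stretch.le] <;> intro h1 h2
        · rw [h1.antisymm h2]
        · exact h1.elim
        · exact h2.elim
        · rw [he (h1.antisymm h2)] }
  let L : β → Ordinal.{u} := fun b => Sum.elim p e b.val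
  have hL : StrictMono L := by
    rintro ⟨a | a⟩ ⟨b | b⟩ hab <;> rw [lt_iff_le_not_ge] at hab <;> obtain ⟨h1, h2⟩ := hab
    · exact hp (lt_of_le_not_ge h1 h2)
    · exact (h1 : False).elim
    · exact h1
    · exact lt_of_not_ge h2
  let wf : WellFoundedLT β := hL.wellFoundedLT
  have hs : ∀ b, ∀ o < L b, ∃ c, c < b ∧ L c = o := by
    rintro ⟨b | b⟩ o ho
    · obtain ⟨w, rfl⟩ := hes o (lt_of_lt_of_le ho (hK b))
      refine ⟨⟨.inr w⟩, ?_, rfl⟩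
      rw [lt_iff_le_not_ge]
      exact ⟨ho, fun h : False => h⟩
    · obtain ⟨w, rfl⟩ := hes o (lt_trans ho (heK b))
      refine ⟨⟨.inr w⟩, ?_, rfl⟩
      rw [lt_iff_le_not_ge]
      exact ⟨ho.le, fun h : e b ≤ e w => absurd ho (not_lt_of_ge h)⟩
  have hlev : ∀ b, level β b = L b := level_eq_of L hL hs
  let f : α ↪o β := 
    { toFun := fun a => ⟨.inl a⟩
      inj' := by
        intro a b hab
        exact Sum.inl_injective (congrArg Stretch.val hab)
      map_rel_iff' := Iff.rfl }
  refine ⟨β, P, wf, f, ?_, ?_⟩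
  · intro a b
    rw [hlev, hlev]
    change _ ↔ k * level α a = k * level α b
    exact ⟨fun h => by rw [h], fun h => mul_left_cancel₀ hk.ne' h⟩
  · rintro ⟨a | a⟩ ⟨b | b⟩ hne hl
    · exact ⟨level α a, hlev _⟩
    · exact ⟨level α a, hlev _⟩
    · exact ⟨level α b, hl.trans (hlev _)⟩
    · rw [hlev, hlev] at hl
      exact (hne (by rw [he hl])).elim

/-- No nacli order has more than one level of size at least 2. -/
theorem stmt18 {α : Type u} [PartialOrder α] [WellFoundedLT α] (h : NacliOrder α)
    {x y u' v : α} (hxy : x ≠ y) (hlxy : level α x = level α y)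
    (huv : u' ≠ v) (hluv : level α u' = level α v) :
    level α x = level α u' := by
  by_contra hne
  obtain ⟨β, _, _, f, hf, hβ⟩ := nacli_aux (α := α) (Order.succ (gap α x u')) (by simp)
  obtain ⟨g, hg⟩ := h β ⟨f, hf⟩
  have gap0 : ∀ {γ : Type u} [PartialOrder γ] [WellFoundedLT γ] (a b : γ),
      gap γ a b = 0 ↔ level γ a = level γ b := by
    intro γ _ _ a b
    unfold gap
    rw [Ordinal.sub_eq_zero_iff_le]
    constructor
    · intro h
      exact le_antisymm ((le_max_left _ _).trans (h.trans (min_le_right _ _)))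
        ((le_max_right _ _).trans (h.trans (min_le_left _ _)))
    · intro h
      simp [h]
  have hlev : ∀ a b, level α a = level α b → level β (g a) = level β (g b) := by
    intro a b hab
    rw [← gap0, ← hg, gap0, hab]
  obtain ⟨s, hs⟩ := hβ _ _ (g.injective.ne hxy) (hlev _ _ hlxy)
  obtain ⟨t, ht⟩ := hβ _ _ (g.injective.ne huv) (hlev _ _ hluv)
  have h1 := hg x u'
  have h2 : gap α x u' ≠ 0 := fun h => hne ((gap0 _ _).1 h)
  generalize gap α x u' = c at *
  have key : ∀ a b : Ordinal.{u}, Order.succ c * a - Order.succ c * b ≠ c := by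
    intro a b hab
    rw [← Ordinal.mul_sub] at hab
    rcases eq_or_ne (a - b) 0 with h0 | h0
    · rw [h0, mul_zero] at hab
      exact h2 hab.symm
    · have h3 : Order.succ c ≤ Order.succ c * (a - b) :=
        Ordinal.le_mul_left _ (pos_iff_ne_zero.2 h0)
      rw [hab] at h3
      exact absurd h3 (not_le_of_gt (Order.lt_succ c))
  unfold gap at h1
  rw [hs, ht] at h1
  rcases le_total (Order.succ c * s) (Order.succ c * t) with h | h
  · rw [max_eq_right h, min_eq_left h] at h1
    exact key _ _ h1.symm
  · rw [max_eq_left h, min_eq_right h] at h1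
    exact key _ _ h1.symm
end
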